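/- arXiv:2304.03814 — 7 statements merged into one kernel-verified Lean document; each statement's English description precedes it below -/
import Mathlib

section
/- For an orean form F and any idempotent closure operator κ on F, the subform F_κ of κ-closed clusters is an orean form. Moreover, F_κ is closed in F under inverse images and finite meets of clusters in the same object (so these are computed in F_κ as in F), while finite joins and direct images in F_κ are given by the κ-closure of the corresponding finite joins and direct images computed in F. -/
open CategoryTheory

universe w v u

/-- A form over a category `C`, presented as a cluster system:
clusters per object and relations `B ≥_f A` (written `Rel f A B`),
satisfying (F1)-(F3). -/
structure Form (C : Type u) [Category.{v} C] where
  Cl : C → Type w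
  Rel : ∀ {X Y : C}, (X ⟶ Y) → Cl X → Cl Y → Prop
  rel_id : ∀ {X : C} (A : Cl X), Rel (𝟙 X) A A
  rel_comp : ∀ {X Y Z : C} {f : X ⟶ Y} {g : Y ⟶ Z} {A : Cl X} {B : Cl Y} {D : Cl Z},
      Rel f A B → Rel g B D → Rel (f ≫ g) A D
  rel_antisymm : ∀ {X : C} {A B : Cl X}, Rel (𝟙 X) A B → Rel (𝟙 X) B A → A = B

namespace Form

variable {C : Type u} [Category.{v} C]

/-- The fibre order on clusters. -/
def le (F : Form C) {X : C} (A B : F.Cl X) : Prop := F.Rel (𝟙 X) A B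

/-- `S` is the image of `f`, i.e. the direct image of the top cluster of the
domain of `f` along `f`. -/
def IsImageOf (F : Form C) {W X : C} (S : F.Cl X) (f : W ⟶ X) : Prop :=
  ∃ t : F.Cl W, (∀ A : F.Cl W, F.le A t) ∧ F.Rel f t S ∧ ∀ T : F.Cl X, F.Rel f t T → F.le S T

/-- `S` is the kernel of `g`, i.e. the inverse image of the bottom cluster of the
codomain of `g` along `g`. -/
def IsKernelOf (F : Form C) {X Y : C} (S : F.Cl X) (g : X ⟶ Y) : Prop :=
  ∃ b : F.Cl Y, (∀ A : F.Cl Y, F.le b A) ∧ F.Rel g S b ∧ ∀ T : F.Cl X, F.Rel g T b → F.le T S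

/-- A cluster is conormal when it is an image of some morphism. -/
def ConormalCl (F : Form C) {X : C} (S : F.Cl X) : Prop :=
  ∃ (W : C) (f : W ⟶ X), F.IsImageOf S f

/-- A cluster is normal when it is a kernel of some morphism. -/
def NormalCl (F : Form C) {X : C} (S : F.Cl X) : Prop :=
  ∃ (Y : C) (g : X ⟶ Y), F.IsKernelOf S g

/-- A form is conormal when every cluster is conormal. -/
def IsConormal (F : Form C) : Prop := ∀ (X : C) (S : F.Cl X), F.ConormalCl S

/-- A form is normal when every cluster is normal. -/
def IsNormal (F : Form C) : Prop := ∀ (X : C) (S : F.Cl X), F.NormalCl S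

def IsJoinOf (F : Form C) {X : C} (A B J : F.Cl X) : Prop :=
  F.le A J ∧ F.le B J ∧ ∀ D : F.Cl X, F.le A D → F.le B D → F.le J D

def IsMeetOf (F : Form C) {X : C} (A B M : F.Cl X) : Prop :=
  F.le M A ∧ F.le M B ∧ ∀ D : F.Cl X, F.le D A → F.le D B → F.le D M

/-- `T` is the direct image of `S` along `f`. -/
def IsDimgOf (F : Form C) {X Y : C} (f : X ⟶ Y) (S : F.Cl X) (T : F.Cl Y) : Prop :=
  F.Rel f S T ∧ ∀ T' : F.Cl Y, F.Rel f S T' → F.le T T'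

/-- `S` is the inverse image of `T` along `f`. -/
def IsIimgOf (F : Form C) {X Y : C} (f : X ⟶ Y) (T : F.Cl Y) (S : F.Cl X) : Prop :=
  F.Rel f S T ∧ ∀ S' : F.Cl X, F.Rel f S' T → F.le S' S

/-- Orean form: (O1) fibres are bounded lattices, (O3) direct and inverse images exist,
(O2) relations along composites decompose. -/
def IsOrean (F : Form C) : Prop :=
  (∀ X : C, ∃ b : F.Cl X, ∀ A, F.le b A) ∧
  (∀ X : C, ∃ t : F.Cl X, ∀ A, F.le A t) ∧
  (∀ (X : C) (A B : F.Cl X), ∃ J, F.IsJoinOf A B J) ∧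
  (∀ (X : C) (A B : F.Cl X), ∃ M, F.IsMeetOf A B M) ∧
  (∀ {X Y : C} (f : X ⟶ Y) (S : F.Cl X), ∃ T, F.IsDimgOf f S T) ∧
  (∀ {X Y : C} (f : X ⟶ Y) (T : F.Cl Y), ∃ S, F.IsIimgOf f T S) ∧
  (∀ {X Y Z : C} (f : X ⟶ Y) (g : Y ⟶ Z) (A : F.Cl X) (D : F.Cl Z),
      F.Rel (f ≫ g) A D → ∃ B : F.Cl Y, F.Rel f A B ∧ F.Rel g B D)

/-- `m` is an embedding of the (conormal) cluster `S`. -/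
def IsEmbeddingOf (F : Form C) {W X : C} (m : W ⟶ X) (S : F.Cl X) : Prop :=
  F.IsImageOf S m ∧ ∀ {W' : C} (f' : W' ⟶ X) (S' : F.Cl X),
    F.IsImageOf S' f' → F.le S' S → ∃! g : W' ⟶ W, g ≫ m = f'

/-- `e` is a quotient of the (normal) cluster `K`. -/
def IsQuotientOf (F : Form C) {X Y : C} (e : X ⟶ Y) (K : F.Cl X) : Prop :=
  F.IsKernelOf K e ∧ ∀ {Y' : C} (g' : X ⟶ Y') (K' : F.Cl X),
    F.IsKernelOf K' g' → F.le K K' → ∃! h : Y ⟶ Y', e ≫ h = g'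

/-- The axiom (N1) for a general form, stated via characterizing predicates. -/
def N1 (F : Form C) : Prop :=
  (∀ {X Y : C} (f : X ⟶ Y) (S V : F.Cl X) (T : F.Cl Y) (K J : F.Cl X),
      F.IsDimgOf f S T → F.IsIimgOf f T V → F.IsKernelOf K f → F.IsJoinOf S K J → V = J) ∧
  (∀ {X Y : C} (f : X ⟶ Y) (T : F.Cl Y) (S : F.Cl X) (U I M : F.Cl Y),
      F.IsIimgOf f T S → F.IsDimgOf f S U → F.IsImageOf I f → F.IsMeetOf T I M → U = M)

/-- The axiom (N2) for a general form. -/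
def N2 (F : Form C) : Prop :=
  ∀ {X Y : C} (f : X ⟶ Y), ∃ (I : C) (e : X ⟶ I) (m : I ⟶ Y) (K : F.Cl X) (S : F.Cl Y),
    F.IsKernelOf K f ∧ F.IsQuotientOf e K ∧ F.IsImageOf S f ∧ F.IsEmbeddingOf m S ∧ e ≫ m = f

/-- The axiom (N3) for a general form. -/
def N3 (F : Form C) : Prop :=
  (∀ {X : C} (S T J : F.Cl X), F.NormalCl S → F.NormalCl T → F.IsJoinOf S T J → F.NormalCl J) ∧
  (∀ {X : C} (S T M : F.Cl X), F.ConormalCl S → F.ConormalCl T → F.IsMeetOf S T M → F.ConormalCl M)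

/-- The subform of `F` given by a selection of clusters. -/
def Subform (F : Form C) (P : ∀ X : C, F.Cl X → Prop) : Form C where
  Cl X := {A : F.Cl X // P X A}
  Rel f A B := F.Rel f A.1 B.1
  rel_id A := F.rel_id A.1
  rel_comp h h' := F.rel_comp h h'
  rel_antisymm h h' := Subtype.ext (F.rel_antisymm h h')

/-- The product of two forms over the same category. -/
def prod (F G : Form C) : Form C where
  Cl X := F.Cl X × G.Cl X
  Rel f A B := F.Rel f A.1 B.1 ∧ G.Rel f A.2 B.2
  rel_id A := ⟨F.rel_id A.1, G.rel_id A.2⟩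
  rel_comp h h' := ⟨F.rel_comp h.1 h'.1, G.rel_comp h.2 h'.2⟩
  rel_antisymm h h' := Prod.ext (F.rel_antisymm h.1 h'.1) (G.rel_antisymm h.2 h'.2)

/-- Isomorphism of forms over the same category. -/
def IsIsomorphic (F G : Form C) : Prop :=
  ∃ e : ∀ X : C, F.Cl X ≃ G.Cl X,
    ∀ {X Y : C} (f : X ⟶ Y) (A : F.Cl X) (B : F.Cl Y),
      F.Rel f A B ↔ G.Rel f (e X A) (e Y B)

/-- An orean factorization (stated for general forms): a conormal orean form together
with a normal orean form such that every morphism factors as a quotient of its kernel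
followed by an embedding of its image. -/
def IsOreanFactorization (Fs Fe : Form C) : Prop :=
  Fs.IsOrean ∧ Fs.IsConormal ∧ Fe.IsOrean ∧ Fe.IsNormal ∧
  ∀ {X Y : C} (f : X ⟶ Y), ∃ (I : C) (e : X ⟶ I) (m : I ⟶ Y) (K : Fe.Cl X) (S : Fs.Cl Y),
    Fe.IsKernelOf K f ∧ Fe.IsQuotientOf e K ∧ Fs.IsImageOf S f ∧ Fs.IsEmbeddingOf m S ∧
    e ≫ m = f

end Form

/-- An operator between two forms over the same category. -/
structure Operator {C : Type u} [Category.{v} C] (F G : Form C) where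
  app : ∀ {X : C}, F.Cl X → G.Cl X
  mono : ∀ {X Y : C} {f : X ⟶ Y} {A : F.Cl X} {B : F.Cl Y},
      F.Rel f A B → G.Rel f (app A) (app B)

namespace Operator

variable {C : Type u} [Category.{v} C] {F G : Form C}

/-- A full operator. -/
def Full (τ : Operator F G) : Prop :=
  ∀ {X Y : C} {f : X ⟶ Y} {A : F.Cl X} {B : F.Cl Y},
    G.Rel f (τ.app A) (τ.app B) → F.Rel f A B

/-- A conormal operator: it maps images of morphisms to images. -/
def Conormal (τ : Operator F G) : Prop :=
  ∀ {W X : C} (f : W ⟶ X) (S : F.Cl X), F.IsImageOf S f → G.IsImageOf (τ.app S) f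

/-- A normal operator: it maps kernels of morphisms to kernels. -/
def Normal (τ : Operator F G) : Prop :=
  ∀ {X Y : C} (g : X ⟶ Y) (S : F.Cl X), F.IsKernelOf S g → G.IsKernelOf (τ.app S) g

end Operator

/-- The identity operator. -/
def Form.idOp {C : Type u} [Category.{v} C] (F : Form C) : Operator F F :=
  ⟨fun A => A, fun h => h⟩

/-- The inclusion of a subform. -/
def Form.subformIncl {C : Type u} [Category.{v} C] (F : Form C) (P : ∀ X : C, F.Cl X → Prop) :
    Operator (F.Subform P) F where
  app A := A.1
  mono h := h

/-- The subform of clusters fixed by an operator `κ : F → F`. -/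
def Form.fixedSubform {C : Type u} [Category.{v} C] (F : Form C) (κ : Operator F F) : Form C :=
  F.Subform (fun _ A => κ.app A = A)

/-- A semiexact pair of forms. -/
def IsSemiexactPair {C : Type u} [Category.{v} C] (Fs Fe : Form C) : Prop :=
  Fs.IsOrean ∧ Fs.IsConormal ∧ Fe.IsOrean ∧ Fe.IsNormal ∧
  (∃ α : Operator Fs Fe, α.Conormal) ∧ (∃ β : Operator Fe Fs, β.Normal)

/-- A left exact pair of forms: a semiexact pair where the conormal operator is a
left inverse of the normal operator. -/
def IsLeftExactPair {C : Type u} [Category.{v} C] (Fs Fe : Form C) : Prop :=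
  Fs.IsOrean ∧ Fs.IsConormal ∧ Fe.IsOrean ∧ Fe.IsNormal ∧
  ∃ (α : Operator Fs Fe) (β : Operator Fe Fs), α.Conormal ∧ β.Normal ∧
    ∀ {X : C} (R : Fe.Cl X), α.app (β.app R) = R

/-- An orean form, with the (uniquely determined) bounded-lattice and
direct/inverse image structure bundled. -/
structure OreanForm (C : Type u) [Category.{v} C] extends Form C where
  bot : ∀ X : C, Cl X
  top : ∀ X : C, Cl X
  join : ∀ {X : C}, Cl X → Cl X → Cl X
  meet : ∀ {X : C}, Cl X → Cl X → Cl X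
  dimg : ∀ {X Y : C}, (X ⟶ Y) → Cl X → Cl Y
  iimg : ∀ {X Y : C}, (X ⟶ Y) → Cl Y → Cl X
  bot_le : ∀ {X : C} (A : Cl X), Rel (𝟙 X) (bot X) A
  le_top : ∀ {X : C} (A : Cl X), Rel (𝟙 X) A (top X)
  le_join_left : ∀ {X : C} (A B : Cl X), Rel (𝟙 X) A (join A B)
  le_join_right : ∀ {X : C} (A B : Cl X), Rel (𝟙 X) B (join A B)
  join_le : ∀ {X : C} {A B D : Cl X}, Rel (𝟙 X) A D → Rel (𝟙 X) B D → Rel (𝟙 X) (join A B) D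
  meet_le_left : ∀ {X : C} (A B : Cl X), Rel (𝟙 X) (meet A B) A
  meet_le_right : ∀ {X : C} (A B : Cl X), Rel (𝟙 X) (meet A B) B
  le_meet : ∀ {X : C} {A B D : Cl X}, Rel (𝟙 X) D A → Rel (𝟙 X) D B → Rel (𝟙 X) D (meet A B)
  rel_dimg : ∀ {X Y : C} (f : X ⟶ Y) (S : Cl X), Rel f S (dimg f S)
  dimg_le : ∀ {X Y : C} {f : X ⟶ Y} {S : Cl X} {T : Cl Y}, Rel f S T → Rel (𝟙 Y) (dimg f S) T
  iimg_rel : ∀ {X Y : C} (f : X ⟶ Y) (T : Cl Y), Rel f (iimg f T) T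
  le_iimg : ∀ {X Y : C} {f : X ⟶ Y} {S : Cl X} {T : Cl Y}, Rel f S T → Rel (𝟙 X) S (iimg f T)
  rel_decomp : ∀ {X Y Z : C} {f : X ⟶ Y} {g : Y ⟶ Z} {A : Cl X} {D : Cl Z},
      Rel (f ≫ g) A D → ∃ B : Cl Y, Rel f A B ∧ Rel g B D

namespace OreanForm

variable {C : Type u} [Category.{v} C]

def le (F : OreanForm C) {X : C} (A B : F.Cl X) : Prop := F.Rel (𝟙 X) A B

/-- The image of a morphism: direct image of the top cluster. -/
def Im (F : OreanForm C) {W X : C} (f : W ⟶ X) : F.Cl X := F.dimg f (F.top W)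

/-- The kernel of a morphism: inverse image of the bottom cluster. -/
def Ker (F : OreanForm C) {X Y : C} (g : X ⟶ Y) : F.Cl X := F.iimg g (F.bot Y)

def Conormal (F : OreanForm C) {X : C} (S : F.Cl X) : Prop :=
  ∃ (W : C) (f : W ⟶ X), F.Im f = S

def Normal (F : OreanForm C) {X : C} (S : F.Cl X) : Prop :=
  ∃ (Y : C) (g : X ⟶ Y), F.Ker g = S

def IsConormalForm (F : OreanForm C) : Prop := ∀ {X : C} (S : F.Cl X), F.Conormal S

def IsNormalForm (F : OreanForm C) : Prop := ∀ {X : C} (S : F.Cl X), F.Normal S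

def IsBinormalForm (F : OreanForm C) : Prop := F.IsConormalForm ∧ F.IsNormalForm

/-- `m` is an embedding of the cluster `S`. -/
def IsEmbedding (F : OreanForm C) {W X : C} (m : W ⟶ X) (S : F.Cl X) : Prop :=
  F.Im m = S ∧ ∀ {W' : C} (f' : W' ⟶ X), F.le (F.Im f') S → ∃! g : W' ⟶ W, g ≫ m = f'

/-- `e` is a quotient of the cluster `K`. -/
def IsQuotient (F : OreanForm C) {X Y : C} (e : X ⟶ Y) (K : F.Cl X) : Prop :=
  F.Ker e = K ∧ ∀ {Y' : C} (g' : X ⟶ Y'), F.le K (F.Ker g') → ∃! h : Y ⟶ Y', e ≫ h = g'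

/-- The axiom (N1) at a given morphism. -/
def N1At (F : OreanForm C) {X Y : C} (f : X ⟶ Y) : Prop :=
  (∀ S : F.Cl X, F.iimg f (F.dimg f S) = F.join S (F.Ker f)) ∧
  (∀ T : F.Cl Y, F.dimg f (F.iimg f T) = F.meet T (F.Im f))

def N1 (F : OreanForm C) : Prop := ∀ {X Y : C} (f : X ⟶ Y), F.N1At f

def N2 (F : OreanForm C) : Prop :=
  ∀ {X Y : C} (f : X ⟶ Y), ∃ (I : C) (e : X ⟶ I) (m : I ⟶ Y),
    F.IsQuotient e (F.Ker f) ∧ F.IsEmbedding m (F.Im f) ∧ e ≫ m = f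

def N3 (F : OreanForm C) : Prop :=
  (∀ {X : C} (S T : F.Cl X), F.Normal S → F.Normal T → F.Normal (F.join S T)) ∧
  (∀ {X : C} (S T : F.Cl X), F.Conormal S → F.Conormal T → F.Conormal (F.meet S T))

def IsNoetherian (F : OreanForm C) : Prop := F.N1 ∧ F.N2 ∧ F.N3

/-- The conormal hull: the subform of conormal clusters. -/
def conormalHull (F : OreanForm C) : Form C := F.toForm.Subform (fun _ S => F.Conormal S)

/-- The normal hull: the subform of normal clusters. -/
def normalHull (F : OreanForm C) : Form C := F.toForm.Subform (fun _ S => F.Normal S)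

def conormalIncl (F : OreanForm C) : Operator F.conormalHull F.toForm :=
  F.toForm.subformIncl _

def normalIncl (F : OreanForm C) : Operator F.normalHull F.toForm :=
  F.toForm.subformIncl _

/-- A strongly orean form: the conormal and normal hulls are both orean. -/
def StronglyOrean (F : OreanForm C) : Prop :=
  F.conormalHull.IsOrean ∧ F.normalHull.IsOrean

/-- `T` is the conormal interior of `S` (largest conormal cluster below `S`). -/
def IsConormalInterior (F : OreanForm C) {X : C} (S T : F.Cl X) : Prop :=
  F.Conormal T ∧ F.le T S ∧ ∀ T' : F.Cl X, F.Conormal T' → F.le T' S → F.le T' T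

/-- `T` is the conormal exterior of `S` (smallest conormal cluster above `S`). -/
def IsConormalExterior (F : OreanForm C) {X : C} (S T : F.Cl X) : Prop :=
  F.Conormal T ∧ F.le S T ∧ ∀ T' : F.Cl X, F.Conormal T' → F.le S T' → F.le T T'

/-- `T` is the normal interior of `S` (largest normal cluster below `S`). -/
def IsNormalInterior (F : OreanForm C) {X : C} (S T : F.Cl X) : Prop :=
  F.Normal T ∧ F.le T S ∧ ∀ T' : F.Cl X, F.Normal T' → F.le T' S → F.le T' T

/-- `T` is the normal exterior of `S` (smallest normal cluster above `S`). -/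
def IsNormalExterior (F : OreanForm C) {X : C} (S T : F.Cl X) : Prop :=
  F.Normal T ∧ F.le S T ∧ ∀ T' : F.Cl X, F.Normal T' → F.le S T' → F.le T T'

/-- Componentwise product of orean forms. -/
def prod (F G : OreanForm C) : OreanForm C where
  toForm := F.toForm.prod G.toForm
  bot X := (F.bot X, G.bot X)
  top X := (F.top X, G.top X)
  join A B := (F.join A.1 B.1, G.join A.2 B.2)
  meet A B := (F.meet A.1 B.1, G.meet A.2 B.2)
  dimg f S := (F.dimg f S.1, G.dimg f S.2)
  iimg f T := (F.iimg f T.1, G.iimg f T.2)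
  bot_le A := ⟨F.bot_le A.1, G.bot_le A.2⟩
  le_top A := ⟨F.le_top A.1, G.le_top A.2⟩
  le_join_left A B := ⟨F.le_join_left A.1 B.1, G.le_join_left A.2 B.2⟩
  le_join_right A B := ⟨F.le_join_right A.1 B.1, G.le_join_right A.2 B.2⟩
  join_le h h' := ⟨F.join_le h.1 h'.1, G.join_le h.2 h'.2⟩
  meet_le_left A B := ⟨F.meet_le_left A.1 B.1, G.meet_le_left A.2 B.2⟩
  meet_le_right A B := ⟨F.meet_le_right A.1 B.1, G.meet_le_right A.2 B.2⟩
  le_meet h h' := ⟨F.le_meet h.1 h'.1, G.le_meet h.2 h'.2⟩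
  rel_dimg f S := ⟨F.rel_dimg f S.1, G.rel_dimg f S.2⟩
  dimg_le h := ⟨F.dimg_le h.1, G.dimg_le h.2⟩
  iimg_rel f T := ⟨F.iimg_rel f T.1, G.iimg_rel f T.2⟩
  le_iimg h := ⟨F.le_iimg h.1, G.le_iimg h.2⟩
  rel_decomp h := by
    obtain ⟨B1, h1, h1'⟩ := F.rel_decomp h.1
    obtain ⟨B2, h2, h2'⟩ := G.rel_decomp h.2
    exact ⟨(B1, B2), ⟨h1, h2⟩, ⟨h1', h2'⟩⟩

end OreanForm

/-- An orean factorization, stated for orean forms. -/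
def OreanFactorization {C : Type u} [Category.{v} C] (Fs Fe : OreanForm C) : Prop :=
  Fs.IsConormalForm ∧ Fe.IsNormalForm ∧
  ∀ {X Y : C} (f : X ⟶ Y), ∃ (I : C) (e : X ⟶ I) (m : I ⟶ Y),
    Fe.IsQuotient e (Fe.Ker f) ∧ Fs.IsEmbedding m (Fs.Im f) ∧ e ≫ m = f

/-- A conormal operator between orean forms (preserves images). -/
def OpConormal {C : Type u} [Category.{v} C] {Fs Fe : OreanForm C}
    (α : Operator Fs.toForm Fe.toForm) : Prop :=
  ∀ {W X : C} (f : W ⟶ X), α.app (Fs.Im f) = Fe.Im f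

/-- A normal operator between orean forms (preserves kernels). -/
def OpNormal {C : Type u} [Category.{v} C] {Fs Fe : OreanForm C}
    (β : Operator Fs.toForm Fe.toForm) : Prop :=
  ∀ {X Y : C} (g : X ⟶ Y), β.app (Fs.Ker g) = Fe.Ker g

/-- `W` is the Wyler join `A ∗ R = (π_R ·ˢ A) ·ˢ π_R` relative to an orean
factorization `(Fs, Fe)`. -/
def WylerJoin {C : Type u} [Category.{v} C] (Fs Fe : OreanForm C) {X : C}
    (A : Fs.Cl X) (R : Fe.Cl X) (W : Fs.Cl X) : Prop :=
  ∃ (Q : C) (p : X ⟶ Q), Fe.IsQuotient p R ∧ Fs.iimg p (Fs.dimg p A) = W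

section Decomp

variable {C : Type u} [Category.{v} C]

/-- Core of a decomposition: a pair of idempotent operators whose subforms of fixed
clusters are a conormal orean form resp. a normal orean form. -/
def IsDecompCore (F : OreanForm C) (κs κe : Operator F.toForm F.toForm) : Prop :=
  (∀ {X : C} (A : F.Cl X), κs.app (κs.app A) = κs.app A) ∧
  (∀ {X : C} (A : F.Cl X), κe.app (κe.app A) = κe.app A) ∧
  (F.toForm.fixedSubform κs).IsOrean ∧ (F.toForm.fixedSubform κs).IsConormal ∧
  (F.toForm.fixedSubform κe).IsOrean ∧ (F.toForm.fixedSubform κe).IsNormal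

def JoinEq (F : OreanForm C) (κs κe : Operator F.toForm F.toForm) : Prop :=
  ∀ {X : C} (S : F.Cl X), S = F.join (κs.app S) (κe.app S)

def MeetEq (F : OreanForm C) (κs κe : Operator F.toForm F.toForm) : Prop :=
  ∀ {X : C} (S : F.Cl X), S = F.meet (κs.app S) (κe.app S)

def LeftEq (F : OreanForm C) (κs : Operator F.toForm F.toForm) : Prop :=
  ∀ {X : C} (S : F.Cl X), S = κs.app S

def RightEq (F : OreanForm C) (κe : Operator F.toForm F.toForm) : Prop :=
  ∀ {X : C} (S : F.Cl X), S = κe.app S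

def TopEq (F : OreanForm C) : Prop := ∀ {X : C} (S : F.Cl X), S = F.top X

def BotEq (F : OreanForm C) : Prop := ∀ {X : C} (S : F.Cl X), S = F.bot X

/-- A decomposition of an orean form: the decomposing term is one of the six
binary bounded-lattice terms. -/
def IsDecomp (F : OreanForm C) (κs κe : Operator F.toForm F.toForm) : Prop :=
  IsDecompCore F κs κe ∧
  (JoinEq F κs κe ∨ MeetEq F κs κe ∨ LeftEq F κs ∨ RightEq F κe ∨ TopEq F ∨ BotEq F)

def IsJoinDecomp (F : OreanForm C) (κs κe : Operator F.toForm F.toForm) : Prop :=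
  IsDecompCore F κs κe ∧ JoinEq F κs κe

def IsMeetDecomp (F : OreanForm C) (κs κe : Operator F.toForm F.toForm) : Prop :=
  IsDecompCore F κs κe ∧ MeetEq F κs κe

def IsLeftDecomp (F : OreanForm C) (κs κe : Operator F.toForm F.toForm) : Prop :=
  IsDecompCore F κs κe ∧ LeftEq F κs

def IsRightDecomp (F : OreanForm C) (κs κe : Operator F.toForm F.toForm) : Prop :=
  IsDecompCore F κs κe ∧ RightEq F κe

/-- A semiexact decomposition: the decomposition projections are binormal and the pair
of fixed subforms is a semiexact pair. -/
def IsSemiexact (F : OreanForm C) (κs κe : Operator F.toForm F.toForm) : Prop :=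
  (∃ τs : Operator F.toForm (F.toForm.fixedSubform κs),
      (∀ {X : C} (A : F.Cl X), (τs.app A).1 = κs.app A) ∧ τs.Conormal ∧ τs.Normal) ∧
  (∃ τe : Operator F.toForm (F.toForm.fixedSubform κe),
      (∀ {X : C} (A : F.Cl X), (τe.app A).1 = κe.app A) ∧ τe.Conormal ∧ τe.Normal) ∧
  IsSemiexactPair (F.toForm.fixedSubform κs) (F.toForm.fixedSubform κe)

/-- An exact decomposition: semiexact, and the subform inclusions are
conormal resp. normal. -/
def IsExact (F : OreanForm C) (κs κe : Operator F.toForm F.toForm) : Prop :=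
  IsSemiexact F κs κe ∧
  (F.toForm.subformIncl (fun _ A => κs.app A = A)).Conormal ∧
  (F.toForm.subformIncl (fun _ A => κe.app A = A)).Normal

end Decomp

/-- Theorem: for an orean form `F` and an idempotent closure operator `κ` on `F`, the
subform `F_κ` of closed clusters is orean; it is closed in `F` under inverse images and
finite meets (so these are computed in `F_κ` as in `F`), while finite joins and direct
images in `F_κ` are the `κ`-closures of those computed in `F`. -/
theorem closed_subform_is_orean {C : Type u} [Category.{v} C]
    (F : OreanForm C) (κ : Operator F.toForm F.toForm)
    (hclos : ∀ {X : C} (A : F.Cl X), F.le A (κ.app A))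
    (hidem : ∀ {X : C} (A : F.Cl X), κ.app (κ.app A) = κ.app A) :
    (F.toForm.fixedSubform κ).IsOrean ∧
    -- closed under inverse images
    (∀ {X Y : C} (f : X ⟶ Y) (T : F.Cl Y), κ.app T = T →
      κ.app (F.iimg f T) = F.iimg f T) ∧
    -- closed under finite meets (top and binary meets)
    (∀ X : C, κ.app (F.top X) = F.top X) ∧
    (∀ {X : C} (S T : F.Cl X), κ.app S = S → κ.app T = T →
      κ.app (F.meet S T) = F.meet S T) ∧
    -- the bottom cluster of `F_κ` is the closure of the bottom cluster of `F`
    (∀ {X : C} (A : F.Cl X), κ.app A = A → F.le (κ.app (F.bot X)) A) ∧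
    -- binary joins in `F_κ` are closures of joins in `F`
    (∀ {X : C} (S T : F.Cl X), κ.app S = S → κ.app T = T →
      F.le S (κ.app (F.join S T)) ∧ F.le T (κ.app (F.join S T)) ∧
      ∀ D : F.Cl X, κ.app D = D → F.le S D → F.le T D → F.le (κ.app (F.join S T)) D) ∧
    -- direct images in `F_κ` are closures of direct images in `F`
    (∀ {X Y : C} (f : X ⟶ Y) (S : F.Cl X), κ.app S = S →
      F.Rel f S (κ.app (F.dimg f S)) ∧
      ∀ T : F.Cl Y, κ.app T = T → F.Rel f S T → F.le (κ.app (F.dimg f S)) T) := by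
  have up : ∀ {X Y : C} {f : X ⟶ Y} {A : F.Cl X} {B D : F.Cl Y},
      F.Rel f A B → F.Rel (𝟙 Y) B D → F.Rel f A D := by
    intro X Y f A B D h h'
    have := F.rel_comp h h'
    rwa [Category.comp_id] at this
  have cl : ∀ {X Y : C} {f : X ⟶ Y} {A : F.Cl X} {D : F.Cl Y},
      κ.app D = D → F.Rel f A D → F.Rel f (κ.app A) D := by
    intro X Y f A D hD h
    have := κ.mono h
    rwa [hD] at this
  have cle : ∀ {X : C} (A : F.Cl X), F.Rel (𝟙 X) A (κ.app A) := fun A => hclos A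
  have hi : ∀ {X Y : C} (f : X ⟶ Y) (T : F.Cl Y), κ.app T = T →
      κ.app (F.iimg f T) = F.iimg f T := fun f T hT =>
    F.rel_antisymm (F.le_iimg (cl hT (F.iimg_rel f T))) (cle _)
  have ht : ∀ X : C, κ.app (F.top X) = F.top X := fun X =>
    F.rel_antisymm (F.le_top _) (cle _)
  have hm : ∀ {X : C} (S T : F.Cl X), κ.app S = S → κ.app T = T →
      κ.app (F.meet S T) = F.meet S T := fun S T hS hT =>
    F.rel_antisymm (F.le_meet (cl hS (F.meet_le_left S T)) (cl hT (F.meet_le_right S T))) (cle _)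
  refine ⟨⟨?_, ?_, ?_, ?_, ?_, ?_, ?_⟩, hi, ht, hm, ?_, ?_, ?_⟩
  · exact fun X => ⟨⟨κ.app (F.bot X), hidem _⟩, fun A => cl A.2 (F.bot_le A.1)⟩
  · exact fun X => ⟨⟨F.top X, ht X⟩, fun A => F.le_top A.1⟩
  · exact fun X A B => ⟨⟨κ.app (F.join A.1 B.1), hidem _⟩,
      up (F.le_join_left A.1 B.1) (cle _), up (F.le_join_right A.1 B.1) (cle _),
      fun D h h' => cl D.2 (F.join_le h h')⟩
  · exact fun X A B => ⟨⟨F.meet A.1 B.1, hm _ _ A.2 B.2⟩,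
      F.meet_le_left A.1 B.1, F.meet_le_right A.1 B.1, fun D h h' => F.le_meet h h'⟩
  · exact fun f S => ⟨⟨κ.app (F.dimg f S.1), hidem _⟩,
      up (F.rel_dimg f S.1) (cle _), fun T h => cl T.2 (F.dimg_le h)⟩
  · exact fun f T => ⟨⟨F.iimg f T.1, hi f _ T.2⟩, F.iimg_rel f T.1, fun S h => F.le_iimg h⟩
  · intro X Y Z f g A D h
    obtain ⟨B, h1, h2⟩ := F.rel_decomp h
    exact ⟨⟨κ.app B, hidem _⟩, up h1 (cle _), cl D.2 h2⟩
  · exact fun A hA => cl hA (F.bot_le A)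
  · exact fun S T _ _ => ⟨up (F.le_join_left S T) (cle _), up (F.le_join_right S T) (cle _),
      fun D hD h h' => cl hD (F.join_le h h')⟩
  · exact fun f S _ => ⟨up (F.rel_dimg f S) (cle _), fun T hT h => cl hT (F.dimg_le h)⟩
end

section
/- Consider families of maps κ = (κ_X)_X, one for each set X, with κ_X : 𝒫(X) → 𝒫(X), satisfying the operator condition: for every function f : X → Y and all subsets A ⊆ X, B ⊆ Y, if f(A) ⊆ B then f(κ_X(A)) ⊆ κ_Y(B). Call κ a closure operator if additionally A ⊆ κ_X(A) for all X and A, and a co-closure operator if κ_X(A) ⊆ A for all X and A. Then: (1) the closure operators are exactly the following three: the identity (κ_X(A) = A), the constant-top operator (κ_X(A) = X), and the operator with κ_X(∅) = ∅ and κ_X(A) = X for every nonempty A ⊆ X; (2) the co-closure operators are exactly two: the identity and the constant-bottom operator (κ_X(A) = ∅). -/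
/-- Closure and co-closure operators on the form of subsets over the category of sets.
The closure operators are exactly: the identity, the constant-top operator, and the
operator fixing empty subsets and sending every nonempty subset to the full set.
The co-closure operators are exactly: the identity and the constant-bottom operator. -/
theorem closure_coclosure_operators_form_of_subsets :
    (∀ κ : (X : Type) → Set X → Set X,
      ((∀ (X Y : Type) (f : X → Y) (A : Set X) (B : Set Y),
          f '' A ⊆ B → f '' (κ X A) ⊆ κ Y B) ∧
        (∀ (X : Type) (A : Set X), A ⊆ κ X A)) ↔
      ((∀ (X : Type) (A : Set X), κ X A = A) ∨
        (∀ (X : Type) (A : Set X), κ X A = Set.univ) ∨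
        (∀ X : Type, κ X ∅ = ∅ ∧ ∀ A : Set X, A.Nonempty → κ X A = Set.univ))) ∧
    (∀ κ : (X : Type) → Set X → Set X,
      ((∀ (X Y : Type) (f : X → Y) (A : Set X) (B : Set Y),
          f '' A ⊆ B → f '' (κ X A) ⊆ κ Y B) ∧
        (∀ (X : Type) (A : Set X), κ X A ⊆ A)) ↔
      ((∀ (X : Type) (A : Set X), κ X A = A) ∨
        (∀ (X : Type) (A : Set X), κ X A = ∅))) := by
  classical
  refine ⟨fun κ => ⟨?_, ?_⟩, fun κ => ⟨?_, ?_⟩⟩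
  · rintro ⟨h, hc⟩
    by_cases h1 : ∃ (X : Type) (x : X), x ∈ κ X ∅
    · obtain ⟨X, x, hx⟩ := h1
      refine Or.inr (Or.inl fun Y B => Set.eq_univ_of_forall fun y => ?_)
      exact h X Y (fun _ => y) ∅ B (by simp) ⟨x, hx, rfl⟩
    · have h1' : ∀ X : Type, κ X ∅ = ∅ := fun X =>
        Set.eq_empty_of_forall_notMem fun x hx => h1 ⟨X, x, hx⟩
      by_cases h2 : ∃ (X : Type) (A : Set X) (x : X), x ∈ κ X A ∧ x ∉ A
      · obtain ⟨X, A, x, hx, hxA⟩ := h2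
        refine Or.inr (Or.inr fun Y => ⟨h1' Y, fun B hB => Set.eq_univ_of_forall fun y => ?_⟩)
        obtain ⟨b, hb⟩ := hB
        refine h X Y (fun z => if z ∈ A then b else y) A B ?_ ⟨x, hx, if_neg hxA⟩
        rintro _ ⟨z, hz, rfl⟩
        simpa [hz] using hb
      · refine Or.inl fun X A => Set.Subset.antisymm (fun x hx => ?_) (hc X A)
        by_contra hxA
        exact h2 ⟨X, A, x, hx, hxA⟩
  · rintro (h | h | h)
    · exact ⟨fun X Y f A B hf => by rw [h, h]; exact hf, fun X A => (h X A).ge⟩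
    · exact ⟨fun X Y f A B _ => by rw [h Y B]; exact Set.subset_univ _,
        fun X A => by rw [h X A]; exact Set.subset_univ _⟩
    · refine ⟨fun X Y f A B hf => ?_, fun X A => ?_⟩
      · rcases A.eq_empty_or_nonempty with rfl | hA
        · rw [(h X).1]; simp
        · rw [(h Y).2 B ((hA.image f).mono hf)]; exact Set.subset_univ _
      · rcases A.eq_empty_or_nonempty with rfl | hA
        · exact Set.empty_subset _
        · rw [(h X).2 A hA]; exact Set.subset_univ _
  · rintro ⟨h, hc⟩
    by_cases h1 : ∃ (X : Type) (A : Set X) (x : X), x ∈ κ X A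
    · obtain ⟨X, A, x, hx⟩ := h1
      refine Or.inl fun Y B => Set.Subset.antisymm (hc Y B) fun b hb => ?_
      refine h X Y (fun _ => b) A B ?_ ⟨x, hx, rfl⟩
      rintro _ ⟨z, hz, rfl⟩
      exact hb
    · exact Or.inr fun X A => Set.eq_empty_of_forall_notMem fun x hx => h1 ⟨X, A, x, hx⟩
  · rintro (h | h)
    · exact ⟨fun X Y f A B hf => by rw [h, h]; exact hf, fun X A => (h X A).le⟩
    · exact ⟨fun X Y f A B _ => by rw [h X A]; simp, fun X A => by rw [h X A]; simp⟩
end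

section
/- Consider families of maps κ = (κ_X)_X, one for each set X, where κ_X sends each equivalence relation on X to an equivalence relation on X, satisfying the operator condition: for every function f : X → Y and all equivalence relations E on X and F on Y, if (x E x' implies f(x) F f(x') for all x, x' ∈ X) then (x κ_X(E) x' implies f(x) κ_Y(F) f(x') for all x, x' ∈ X). Call κ a closure operator if additionally E ⊆ κ_X(E) (as relations) for all X, E, and a co-closure operator if κ_X(E) ⊆ E for all X, E. Then: (1) the closure operators are exactly two: the identity and the operator sending every equivalence relation to the total relation on X; (2) the co-closure operators are exactly two: the identity and the operator sending every equivalence relation to the equality relation on X. -/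
/-- Closure and co-closure operators on the form of equivalence relations over the
category of sets. The closure operators are exactly the identity and the operator
sending every equivalence relation to the total relation; the co-closure operators
are exactly the identity and the operator sending every equivalence relation to the
equality relation. -/
theorem closure_coclosure_operators_form_of_equivalence_relations :
    (∀ κ : (X : Type) → Setoid X → Setoid X,
      ((∀ (X Y : Type) (f : X → Y) (E : Setoid X) (F : Setoid Y),
          (∀ x x' : X, E.r x x' → F.r (f x) (f x')) →
          (∀ x x' : X, (κ X E).r x x' → (κ Y F).r (f x) (f x'))) ∧
        (∀ (X : Type) (E : Setoid X) (x x' : X), E.r x x' → (κ X E).r x x')) ↔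
      ((∀ (X : Type) (E : Setoid X), κ X E = E) ∨
        (∀ (X : Type) (E : Setoid X) (x x' : X), (κ X E).r x x'))) ∧
    (∀ κ : (X : Type) → Setoid X → Setoid X,
      ((∀ (X Y : Type) (f : X → Y) (E : Setoid X) (F : Setoid Y),
          (∀ x x' : X, E.r x x' → F.r (f x) (f x')) →
          (∀ x x' : X, (κ X E).r x x' → (κ Y F).r (f x) (f x'))) ∧
        (∀ (X : Type) (E : Setoid X) (x x' : X), (κ X E).r x x' → E.r x x')) ↔
      ((∀ (X : Type) (E : Setoid X), κ X E = E) ∨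
        (∀ (X : Type) (E : Setoid X) (x x' : X), (κ X E).r x x' → x = x'))) := by
  classical
  refine ⟨fun κ => ⟨?_, ?_⟩, fun κ => ⟨?_, ?_⟩⟩
  · rintro ⟨hop, hcl⟩
    by_cases h : ∀ (X : Type) (E : Setoid X) (x x' : X), (κ X E).r x x' → E.r x x'
    · left
      intro X E
      exact Setoid.ext fun a b => ⟨h X E a b, hcl X E a b⟩
    · right
      push Not at h
      obtain ⟨X, E, x, x', hk, hn⟩ := h
      intro Y F y y'
      have key := hop X Y (fun z => if E.r x z then y else y') E F (by
        intro a b hab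
        have hiff : E.r x a ↔ E.r x b :=
          ⟨fun h => E.iseqv.trans h hab, fun h => E.iseqv.trans h (E.iseqv.symm hab)⟩
        simp only [hiff]
        exact F.iseqv.refl _) x x' hk
      have hx : E.r x x := E.iseqv.refl x
      simpa only [if_pos hx, if_neg hn] using key
  · rintro (h | h)
    · refine ⟨fun X Y f E F hf => ?_, fun X E => ?_⟩
      · rw [h, h]; exact hf
      · rw [h]; exact fun _ _ h => h
    · exact ⟨fun X Y f E F _ x x' _ => h Y F _ _, fun X E x x' _ => h X E x x'⟩
  · rintro ⟨hop, hcl⟩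
    by_cases h : ∀ (X : Type) (E : Setoid X) (x x' : X), (κ X E).r x x' → x = x'
    · exact Or.inr h
    · left
      push Not at h
      obtain ⟨X, E, x, x', hk, hn⟩ := h
      intro Y F
      refine Setoid.ext fun y y' => ⟨hcl Y F y y', fun hy => ?_⟩
      have key := hop X Y (fun z => if x = z then y else y') E F (by
        intro a b _
        split_ifs
        · exact F.iseqv.refl _
        · exact hy
        · exact F.iseqv.symm hy
        · exact F.iseqv.refl _) x x' hk
      simpa only [if_true, if_neg hn] using key
  · rintro (h | h)
    · refine ⟨fun X Y f E F hf => ?_, fun X E => ?_⟩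
      · rw [h, h]; exact hf
      · rw [h]; exact fun _ _ h => h
    · refine ⟨fun X Y f E F _ x x' hx => ?_, fun X E x x' hx => ?_⟩
      · rw [h X E x x' hx]
      · rw [h X E x x' hx]
end

section
/- Let F be an orean form over a category, let B be a conormal cluster in an object Y whose embedding is a morphism m : M → Y, and let f : X → Y be a morphism such that the inverse image B·f is conormal. Then a morphism m' : M' → X is an embedding of B·f if and only if m' is a pullback of m along f, i.e., there is a morphism f' : M' → M with f ∘ m' = m ∘ f' such that this square is a pullback square. -/
open CategoryTheory

universe w v u

namespace OreanForm

variable {C : Type u} [Category.{v} C]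

theorem aux_rel_of_im_le (F : OreanForm C) {W X : C} {h : W ⟶ X} {S : F.Cl X}
    (H : F.le (F.Im h) S) : F.Rel h (F.top W) S := by
  have h1 := F.rel_comp (F.rel_dimg h (F.top W)) H
  rwa [Category.comp_id] at h1

theorem aux_im_le (F : OreanForm C) {W X : C} {h : W ⟶ X} {S : F.Cl X}
    (H : F.Rel h (F.top W) S) : F.le (F.Im h) S := F.dimg_le H

theorem aux_rel_factor (F : OreanForm C) {W M X : C} (k : W ⟶ M) (m : M ⟶ X) :
    F.Rel (k ≫ m) (F.top W) (F.Im m) := by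
  have h1 := F.rel_comp (F.rel_dimg k (F.top W)) (F.le_top _)
  rw [Category.comp_id] at h1
  exact F.rel_comp h1 (F.rel_dimg m (F.top M))

theorem aux_rel_iimg_iff (F : OreanForm C) {W X Y : C} (h : W ⟶ X) (f : X ⟶ Y) (B : F.Cl Y) :
    F.Rel h (F.top W) (F.iimg f B) ↔ F.Rel (h ≫ f) (F.top W) B := by
  constructor
  · intro H
    exact F.rel_comp H (F.iimg_rel f B)
  · intro H
    obtain ⟨D, h1, h2⟩ := F.rel_decomp H
    have h3 := F.rel_comp h1 (F.le_iimg h2)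
    rwa [Category.comp_id] at h3

end OreanForm

/-- Lemma: for an orean form `F`, a conormal cluster `B` in `Y` with embedding
`m : M ⟶ Y`, and a morphism `f : X ⟶ Y` such that the inverse image `B · f` is
conormal, a morphism `m' : M' ⟶ X` is an embedding of `B · f` if and only if `m'`
is a pullback of `m` along `f`. -/
theorem embedding_of_inverse_image_iff_pullback {C : Type u} [Category.{v} C]
    (F : OreanForm C) {M X Y : C} {B : F.Cl Y} (m : M ⟶ Y)
    (hm : F.IsEmbedding m B) (f : X ⟶ Y) (hBf : F.Conormal (F.iimg f B))
    {M' : C} (m' : M' ⟶ X) :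
    F.IsEmbedding m' (F.iimg f B) ↔ ∃ f' : M' ⟶ M, IsPullback m' f' f m := by
  obtain ⟨hI, hU⟩ := hm
  have hU' : ∀ {W : C} (g : W ⟶ Y), F.Rel g (F.top W) B → ∃! k : W ⟶ M, k ≫ m = g :=
    fun g hg => hU g (F.aux_im_le hg)
  have hfac : ∀ {W : C} (k : W ⟶ M), F.Rel (k ≫ m) (F.top W) B := fun k => by
    have h1 := F.aux_rel_factor k m
    rwa [hI] at h1
  have hmono : ∀ {W : C} (a b : W ⟶ M), a ≫ m = b ≫ m → a = b := fun a b hab =>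
    (hU' (b ≫ m) (hfac b)).unique hab rfl
  constructor
  · rintro ⟨hI', hV⟩
    have h1 : F.Rel m' (F.top M') (F.iimg f B) := by
      rw [← hI']
      exact F.rel_dimg m' (F.top M')
    obtain ⟨f', hf', -⟩ := hU' (m' ≫ f) ((F.aux_rel_iimg_iff m' f B).1 h1)
    have key : ∀ {W : C} (p : W ⟶ X) (q : W ⟶ M), p ≫ f = q ≫ m →
        ∃! g : W ⟶ M', g ≫ m' = p := fun p q hpq =>
      hV p (F.aux_im_le ((F.aux_rel_iimg_iff p f B).2 (by rw [hpq]; exact hfac q)))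
    refine ⟨f', ⟨⟨hf'.symm⟩, ⟨Limits.PullbackCone.IsLimit.mk hf'.symm
      (fun s => (key s.fst s.snd s.condition).choose)
      (fun s => (key s.fst s.snd s.condition).choose_spec.1) (fun s => ?_)
      (fun s t ht _ => (key s.fst s.snd s.condition).choose_spec.2 t ht)⟩⟩⟩
    have h2 := (key s.fst s.snd s.condition).choose_spec.1
    apply hmono
    rw [Category.assoc, hf', ← s.condition, ← Category.assoc]
    exact congrArg (· ≫ f) h2
  · rintro ⟨f', hp⟩
    have key : ∀ {W : C} (h : W ⟶ X), F.le (F.Im h) (F.iimg f B) →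
        ∃! g : W ⟶ M', g ≫ m' = h := by
      intro W h hh
      obtain ⟨k, hk, -⟩ := hU' (h ≫ f) ((F.aux_rel_iimg_iff h f B).1 (F.aux_rel_of_im_le hh))
      refine ⟨hp.lift h k hk.symm, hp.lift_fst _ _ _, fun g hg => ?_⟩
      apply hp.hom_ext
      · rw [hp.lift_fst]
        exact hg
      · apply hmono
        rw [hp.lift_snd, hk, Category.assoc, ← hp.w, ← Category.assoc, hg]
    refine ⟨F.rel_antisymm ?_ ?_, fun h hh => key h hh⟩
    · refine F.aux_im_le ((F.aux_rel_iimg_iff m' f B).2 ?_)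
      rw [hp.w]
      exact hfac f'
    · obtain ⟨W, h, hh⟩ := hBf
      obtain ⟨g, hg, -⟩ := key h (by rw [hh]; exact F.rel_id _)
      rw [← hh]
      apply F.aux_im_le
      rw [← hg]
      exact F.aux_rel_factor g m'
end

section
/- Let F be an orean form over a category C. For a morphism f : X → Y of C, the following conditions are equivalent: (i) f is an isomorphism; (ii) f is an embedding of the top cluster ⊤_Y in Y; (iii) f is a quotient of the bottom cluster ⊥_X in X. -/
open CategoryTheory

universe w v u

/-- Lemma: for an orean form `F` and a morphism `f : X ⟶ Y`, the following are
equivalent: `f` is an isomorphism; `f` is an embedding of the top cluster of `Y`;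
`f` is a quotient of the bottom cluster of `X`. -/
theorem iso_iff_embedding_top_iff_quotient_bot {C : Type u} [Category.{v} C]
    (F : OreanForm C) {X Y : C} (f : X ⟶ Y) :
    (IsIso f ↔ F.IsEmbedding f (F.top Y)) ∧ (IsIso f ↔ F.IsQuotient f (F.bot X)) := by
  refine ⟨⟨fun hf => ⟨?_, ?_⟩, fun ⟨_, hu⟩ => ?_⟩, ⟨fun hf => ⟨?_, ?_⟩, fun ⟨_, hu⟩ => ?_⟩⟩
  · apply F.rel_antisymm (F.le_top _)
    have h1 := F.rel_comp (F.rel_dimg (inv f) (F.top Y)) (F.le_top _)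
    have h2 := F.rel_comp h1 (F.rel_dimg f (F.top X))
    simpa [OreanForm.Im] using h2
  · intro W' f' _
    refine ⟨f' ≫ inv f, by simp, fun y hy => ?_⟩
    simp [← hy]
  · obtain ⟨g, hg, _⟩ := hu (𝟙 Y) (F.le_top _)
    obtain ⟨k, _, hk⟩ := hu f (F.le_top _)
    refine ⟨g, ?_, hg⟩
    have hg' : g ≫ f = 𝟙 Y := hg
    exact (hk (f ≫ g) (by simp [hg'])).trans (hk (𝟙 X) (by simp)).symm
  · refine F.rel_antisymm ?_ (F.bot_le _)
    have h1 := F.rel_comp (F.bot_le _) (F.iimg_rel (inv f) (F.bot X))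
    have h2 := F.rel_comp (F.iimg_rel f (F.bot Y)) h1
    simpa [OreanForm.Ker] using h2
  · intro Y' g' _
    refine ⟨inv f ≫ g', by simp, fun y hy => ?_⟩
    simp [← hy]
  · obtain ⟨g, hg, _⟩ := hu (𝟙 X) (F.bot_le _)
    obtain ⟨k, _, hk⟩ := hu f (F.bot_le _)
    refine ⟨g, hg, ?_⟩
    have hg' : f ≫ g = 𝟙 X := hg
    exact (hk (g ≫ f) (by simp [← Category.assoc, hg'])).trans (hk (𝟙 Y) (by simp)).symm
end

section
/- Let (F_s, F_e) be an orean factorization of a category C. Then: (1) a morphism is an F_s-embedding if and only if its F_e-kernel is a bottom cluster, and dually a morphism is an F_e-quotient if and only if its F_s-image is a top cluster; (2) the composite ι^s_A ∘ ι^s_B of two F_s-embeddings is an F_s-embedding, namely an embedding of ι^s_A ·^s B, and dually the composite π^e_S ∘ π^e_R of two F_e-quotients is an F_e-quotient of S ·^e π^e_R; (3) the F_s-kernel of every F_s-embedding f is a bottom cluster and (N1) holds for f relative to the form F_s, and dually the F_e-image of every F_e-quotient f is a top cluster and (N1) holds for f relative to F_e. -/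
open CategoryTheory

universe w v u

namespace OreanForm

variable {C : Type u} [Category.{v} C]

theorem le_trans' (F : OreanForm C) {X : C} {A B D : F.Cl X}
    (h : F.Rel (𝟙 X) A B) (h' : F.Rel (𝟙 X) B D) : F.Rel (𝟙 X) A D := by
  simpa using F.rel_comp h h'

theorem rel_iff_dimg (F : OreanForm C) {X Y : C} (f : X ⟶ Y) (S : F.Cl X) (T : F.Cl Y) :
    F.Rel f S T ↔ F.Rel (𝟙 Y) (F.dimg f S) T :=
  ⟨F.dimg_le, fun h => by simpa using F.rel_comp (F.rel_dimg f S) h⟩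

theorem rel_iff_iimg (F : OreanForm C) {X Y : C} (f : X ⟶ Y) (S : F.Cl X) (T : F.Cl Y) :
    F.Rel f S T ↔ F.Rel (𝟙 X) S (F.iimg f T) :=
  ⟨F.le_iimg, fun h => by simpa using F.rel_comp h (F.iimg_rel f T)⟩

theorem dimg_mono (F : OreanForm C) {X Y : C} (f : X ⟶ Y) {S S' : F.Cl X}
    (h : F.Rel (𝟙 X) S S') : F.Rel (𝟙 Y) (F.dimg f S) (F.dimg f S') :=
  F.dimg_le (by simpa using F.rel_comp h (F.rel_dimg f S'))

theorem dimg_comp (F : OreanForm C) {X Y Z : C} (f : X ⟶ Y) (g : Y ⟶ Z) (S : F.Cl X) :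
    F.dimg (f ≫ g) S = F.dimg g (F.dimg f S) := by
  apply F.rel_antisymm
  · exact F.dimg_le (F.rel_comp (F.rel_dimg f S) (F.rel_dimg g _))
  · obtain ⟨B, h1, h2⟩ := F.rel_decomp (F.rel_dimg (f ≫ g) S)
    exact F.le_trans' (F.dimg_mono g (F.dimg_le h1)) (F.dimg_le h2)

theorem iimg_mono (F : OreanForm C) {X Y : C} (f : X ⟶ Y) {T T' : F.Cl Y}
    (h : F.Rel (𝟙 Y) T T') : F.Rel (𝟙 X) (F.iimg f T) (F.iimg f T') :=
  F.le_iimg (by simpa using F.rel_comp (F.iimg_rel f T) h)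

theorem iimg_comp (F : OreanForm C) {X Y Z : C} (f : X ⟶ Y) (g : Y ⟶ Z) (T : F.Cl Z) :
    F.iimg (f ≫ g) T = F.iimg f (F.iimg g T) := by
  apply F.rel_antisymm
  · obtain ⟨B, h1, h2⟩ := F.rel_decomp (F.iimg_rel (f ≫ g) T)
    exact F.le_trans' (F.le_iimg h1) (F.iimg_mono f (F.le_iimg h2))
  · exact F.le_iimg (F.rel_comp (F.iimg_rel f _) (F.iimg_rel g T))

theorem dimg_bot (F : OreanForm C) {X Y : C} (f : X ⟶ Y) : F.dimg f (F.bot X) = F.bot Y :=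
  F.rel_antisymm (F.dimg_le ((F.rel_iff_iimg _ _ _).2 (F.bot_le _))) (F.bot_le _)

theorem iimg_top (F : OreanForm C) {X Y : C} (f : X ⟶ Y) : F.iimg f (F.top Y) = F.top X :=
  F.rel_antisymm (F.le_top _) (F.le_iimg ((F.rel_iff_dimg _ _ _).2 (F.le_top _)))

theorem Im_comp (F : OreanForm C) {X Y Z : C} (f : X ⟶ Y) (g : Y ⟶ Z) :
    F.Im (f ≫ g) = F.dimg g (F.Im f) := F.dimg_comp f g _

theorem Im_comp_le (F : OreanForm C) {X Y Z : C} (f : X ⟶ Y) (g : Y ⟶ Z) :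
    F.Rel (𝟙 Z) (F.Im (f ≫ g)) (F.Im g) := by
  rw [Im_comp]; exact F.dimg_mono g (F.le_top _)

theorem Ker_comp (F : OreanForm C) {X Y Z : C} (f : X ⟶ Y) (g : Y ⟶ Z) :
    F.Ker (f ≫ g) = F.iimg f (F.Ker g) := F.iimg_comp f g _

theorem le_Ker_comp (F : OreanForm C) {X Y Z : C} (f : X ⟶ Y) (g : Y ⟶ Z) :
    F.Rel (𝟙 X) (F.Ker f) (F.Ker (f ≫ g)) := by
  rw [Ker_comp]; exact F.iimg_mono f (F.bot_le _)

theorem Ker_iso (F : OreanForm C) {X Y : C} (e : X ⟶ Y) (i : Y ⟶ X) (h : e ≫ i = 𝟙 X) :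
    F.Ker e = F.bot X := by
  refine F.rel_antisymm ?_ (F.bot_le _)
  have h1 : F.Rel i (F.bot Y) (F.bot X) := (F.rel_iff_iimg _ _ _).2 (F.bot_le _)
  have h2 := F.rel_comp (F.iimg_rel e (F.bot Y)) h1
  rwa [h] at h2

theorem Im_iso (F : OreanForm C) {X Y : C} (e : X ⟶ Y) (i : Y ⟶ X) (h : i ≫ e = 𝟙 Y) :
    F.Im e = F.top Y := by
  refine F.rel_antisymm (F.le_top _) ?_
  have h1 : F.Rel i (F.top Y) (F.top X) := (F.rel_iff_dimg _ _ _).2 (F.le_top _)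
  have h2 := F.rel_comp h1 (F.rel_dimg e (F.top X))
  rwa [h] at h2

theorem IsEmbedding.mono {F : OreanForm C} {X Y W : C} {m : X ⟶ Y} {S : F.Cl Y}
    (hm : F.IsEmbedding m S) {a b : W ⟶ X} (h : a ≫ m = b ≫ m) : a = b := by
  have hle : F.le (F.Im (b ≫ m)) S := by
    rw [← hm.1]; exact F.Im_comp_le b m
  exact (hm.2 (b ≫ m) hle).unique h rfl

theorem IsQuotient.epi {F : OreanForm C} {X Y W : C} {e : X ⟶ Y} {R : F.Cl X}
    (he : F.IsQuotient e R) {a b : Y ⟶ W} (h : e ≫ a = e ≫ b) : a = b := by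
  have hle : F.le R (F.Ker (e ≫ b)) := by
    rw [← he.1]; exact F.le_Ker_comp e b
  exact (he.2 (e ≫ b) hle).unique h rfl

/-- The dual orean form over the opposite category. -/
def opForm (F : OreanForm C) : OreanForm Cᵒᵖ where
  Cl X := F.Cl X.unop
  Rel f A B := F.Rel f.unop B A
  rel_id A := F.rel_id A
  rel_comp h h' := F.rel_comp h' h
  rel_antisymm h h' := F.rel_antisymm h' h
  bot X := F.top X.unop
  top X := F.bot X.unop
  join A B := F.meet A B
  meet A B := F.join A B
  dimg f S := F.iimg f.unop S
  iimg f T := F.dimg f.unop T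
  bot_le A := F.le_top A
  le_top A := F.bot_le A
  le_join_left A B := F.meet_le_left A B
  le_join_right A B := F.meet_le_right A B
  join_le h h' := F.le_meet h h'
  meet_le_left A B := F.le_join_left A B
  meet_le_right A B := F.le_join_right A B
  le_meet h h' := F.join_le h h'
  rel_dimg f S := F.iimg_rel f.unop S
  dimg_le h := F.le_iimg h
  iimg_rel f T := F.rel_dimg f.unop T
  le_iimg h := F.dimg_le h
  rel_decomp h := by
    obtain ⟨B, h1, h2⟩ := F.rel_decomp h
    exact ⟨B, h2, h1⟩

theorem opForm_isEmbedding (F : OreanForm C) {X Y : C} (e : X ⟶ Y) (R : F.Cl X) :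
    F.opForm.IsEmbedding e.op (R : F.opForm.Cl (Opposite.op X)) ↔ F.IsQuotient e R := by
  constructor
  · rintro ⟨h1, h2⟩
    refine ⟨h1, fun {Y'} g' hg => ?_⟩
    obtain ⟨k, hk, hu⟩ := h2 g'.op hg
    exact ⟨k.unop, congrArg Quiver.Hom.unop hk,
      fun y hy => congrArg Quiver.Hom.unop (hu y.op (congrArg Quiver.Hom.op hy))⟩
  · rintro ⟨h1, h2⟩
    refine ⟨h1, fun {W'} g' hg => ?_⟩
    obtain ⟨k, hk, hu⟩ := h2 g'.unop hg
    exact ⟨k.op, congrArg Quiver.Hom.op hk,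
      fun y hy => congrArg Quiver.Hom.op (hu y.unop (congrArg Quiver.Hom.unop hy))⟩

theorem opForm_isQuotient (F : OreanForm C) {X Y : C} (m : X ⟶ Y) (S : F.Cl Y) :
    F.opForm.IsQuotient m.op (S : F.opForm.Cl (Opposite.op Y)) ↔ F.IsEmbedding m S := by
  constructor
  · rintro ⟨h1, h2⟩
    refine ⟨h1, fun {Y'} g' hg => ?_⟩
    obtain ⟨k, hk, hu⟩ := h2 g'.op hg
    exact ⟨k.unop, congrArg Quiver.Hom.unop hk,
      fun y hy => congrArg Quiver.Hom.unop (hu y.op (congrArg Quiver.Hom.op hy))⟩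
  · rintro ⟨h1, h2⟩
    refine ⟨h1, fun {W'} g' hg => ?_⟩
    obtain ⟨k, hk, hu⟩ := h2 g'.unop hg
    exact ⟨k.op, congrArg Quiver.Hom.op hk,
      fun y hy => congrArg Quiver.Hom.op (hu y.unop (congrArg Quiver.Hom.unop hy))⟩

end OreanForm

section Factorization

variable {C : Type u} [Category.{v} C]

theorem OreanFactorization.opFact {Fs Fe : OreanForm C} (h : OreanFactorization Fs Fe) :
    OreanFactorization Fe.opForm Fs.opForm := by
  obtain ⟨h1, h2, h3⟩ := h
  refine ⟨fun {X} S => ?_, fun {X} S => ?_, fun {X Y} f => ?_⟩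
  · obtain ⟨Y, g, hg⟩ := h2 (X := X.unop) S
    exact ⟨Opposite.op Y, g.op, hg⟩
  · obtain ⟨Y, g, hg⟩ := h1 (X := X.unop) S
    exact ⟨Opposite.op Y, g.op, hg⟩
  · obtain ⟨I, e, m, he, hm, hem⟩ := h3 f.unop
    exact ⟨Opposite.op I, m.op, e.op, (Fs.opForm_isQuotient m _).2 hm,
      (Fe.opForm_isEmbedding e _).2 he, congrArg Quiver.Hom.op hem⟩

theorem OreanFactorization.embedding_iff {Fs Fe : OreanForm C} (h : OreanFactorization Fs Fe)
    {X Y : C} (m : X ⟶ Y) : (∃ S : Fs.Cl Y, Fs.IsEmbedding m S) ↔ Fe.Ker m = Fe.bot X := by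
  obtain ⟨I, e, m', he, hm', rfl⟩ := h.2.2 m
  constructor
  · rintro ⟨S, hS⟩
    have hle : Fs.le (Fs.Im m') S := by
      rw [← hS.1, ← hm'.1]; exact Fs.rel_id _
    obtain ⟨g, hg, -⟩ := hS.2 m' hle
    have h1 : e ≫ g = 𝟙 X := hS.mono (by simp [hg])
    rw [← he.1]
    exact Fe.Ker_iso e g h1
  · intro hK
    rw [hK] at he
    obtain ⟨g, hg, -⟩ := he.2 (𝟙 X) (Fe.bot_le _)
    have hge : g ≫ e = 𝟙 I := he.epi (by rw [← Category.assoc, hg]; simp)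
    refine ⟨_, rfl, fun {W'} f' hf' => ?_⟩
    obtain ⟨k, hk, -⟩ := hm'.2 f' hf'
    refine ⟨k ≫ g, ?_, fun y hy => ?_⟩
    · change (k ≫ g) ≫ e ≫ m' = f'
      rw [Category.assoc, ← Category.assoc g, hge, Category.id_comp, hk]
    · have : y ≫ e = k := hm'.mono (by rw [Category.assoc, hk]; exact hy)
      rw [← this, Category.assoc, hg, Category.comp_id]

theorem OreanFactorization.embedding_comp {Fs Fe : OreanForm C} (h : OreanFactorization Fs Fe)
    {X Y Z : C} (mB : X ⟶ Y) (mA : Y ⟶ Z) (B : Fs.Cl Y) (A : Fs.Cl Z)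
    (hB : Fs.IsEmbedding mB B) (hA : Fs.IsEmbedding mA A) :
    Fs.IsEmbedding (mB ≫ mA) (Fs.dimg mA B) := by
  have kB := (h.embedding_iff mB).1 ⟨B, hB⟩
  have kA := (h.embedding_iff mA).1 ⟨A, hA⟩
  have k : Fe.Ker (mB ≫ mA) = Fe.bot X := by
    rw [Fe.Ker_comp, kA]; exact kB
  obtain ⟨S, hS⟩ := (h.embedding_iff _).2 k
  have : S = Fs.dimg mA B := by rw [← hS.1, Fs.Im_comp, hB.1]
  exact this ▸ hS

theorem OreanFactorization.exists_embedding {Fs Fe : OreanForm C}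
    (h : OreanFactorization Fs Fe) {X : C} (S : Fs.Cl X) :
    ∃ (W : C) (m : W ⟶ X), Fs.IsEmbedding m S := by
  obtain ⟨W, f, rfl⟩ := h.1 S
  obtain ⟨I, e, m, -, hm, -⟩ := h.2.2 f
  exact ⟨I, m, hm⟩

theorem OreanFactorization.embedding_N1 {Fs Fe : OreanForm C} (h : OreanFactorization Fs Fe)
    {W X : C} (m : W ⟶ X) (A : Fs.Cl X) (hm : Fs.IsEmbedding m A) :
    Fs.Ker m = Fs.bot W ∧ Fs.N1At m := by
  have key : ∀ S : Fs.Cl W, Fs.iimg m (Fs.dimg m S) = S := by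
    intro S
    refine Fs.rel_antisymm ?_ (Fs.le_iimg (Fs.rel_dimg m S))
    obtain ⟨U, s, hs⟩ := h.exists_embedding S
    obtain ⟨V, t, ht⟩ := h.exists_embedding (Fs.iimg m (Fs.dimg m S))
    have hle : Fs.le (Fs.Im (t ≫ m)) (Fs.dimg m S) := by
      rw [Fs.Im_comp, ht.1]
      exact Fs.dimg_le (Fs.iimg_rel m _)
    obtain ⟨g, hg, -⟩ := (h.embedding_comp s m S A hs hm).2 (t ≫ m) hle
    have hgt : g ≫ s = t := hm.mono (by rw [Category.assoc]; exact hg)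
    have := Fs.Im_comp_le g s
    rwa [hgt, ht.1, hs.1] at this
  have hker : Fs.Ker m = Fs.bot W := by
    have := key (Fs.bot W)
    rwa [Fs.dimg_bot] at this
  refine ⟨hker, fun S => ?_, fun T => ?_⟩
  · rw [key, hker]
    exact Fs.rel_antisymm (Fs.le_join_left _ _) (Fs.join_le (Fs.rel_id _) (Fs.bot_le _))
  · apply Fs.rel_antisymm
    · exact Fs.le_meet (Fs.dimg_le (Fs.iimg_rel m T)) (Fs.dimg_mono m (Fs.le_top _))
    · obtain ⟨U, f, hf⟩ := h.1 (Fs.meet T (Fs.Im m))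
      have hle : Fs.le (Fs.Im f) A := by
        rw [hf, ← hm.1]; exact Fs.meet_le_right _ _
      obtain ⟨g, hg, -⟩ := hm.2 f hle
      have hT := Fs.meet_le_left T (Fs.Im m)
      rw [← hf, ← hg, Fs.Im_comp] at hT ⊢
      exact Fs.dimg_mono m (Fs.le_iimg ((Fs.rel_iff_dimg _ _ _).2 hT))

end Factorization

/-- Lemma (properties of an orean factorization): characterization of embeddings by
trivial kernels and of quotients by full images; closites of embeddings/quotients
compose; and (N1) holds at embeddings and quotients. -/
theorem orean_factorization_embeddings_quotients {C : Type u} [Category.{v} C]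
    (Fs Fe : OreanForm C) (h : OreanFactorization Fs Fe) :
    (∀ {X Y : C} (m : X ⟶ Y), (∃ S : Fs.Cl Y, Fs.IsEmbedding m S) ↔ Fe.Ker m = Fe.bot X) ∧
    (∀ {X Y : C} (e : X ⟶ Y), (∃ R : Fe.Cl X, Fe.IsQuotient e R) ↔ Fs.Im e = Fs.top Y) ∧
    (∀ {X Y Z : C} (mB : X ⟶ Y) (mA : Y ⟶ Z) (B : Fs.Cl Y) (A : Fs.Cl Z),
      Fs.IsEmbedding mB B → Fs.IsEmbedding mA A →
        Fs.IsEmbedding (mB ≫ mA) (Fs.dimg mA B)) ∧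
    (∀ {X Y Z : C} (pR : X ⟶ Y) (pS : Y ⟶ Z) (R : Fe.Cl X) (S : Fe.Cl Y),
      Fe.IsQuotient pR R → Fe.IsQuotient pS S →
        Fe.IsQuotient (pR ≫ pS) (Fe.iimg pR S)) ∧
    (∀ {W X : C} (m : W ⟶ X) (S : Fs.Cl X), Fs.IsEmbedding m S →
      Fs.Ker m = Fs.bot W ∧ Fs.N1At m) ∧
    (∀ {X Y : C} (e : X ⟶ Y) (R : Fe.Cl X), Fe.IsQuotient e R →
      Fe.Im e = Fe.top Y ∧ Fe.N1At e) := by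
  refine ⟨h.embedding_iff, fun {X Y} e => ?_, h.embedding_comp, ?_, h.embedding_N1, ?_⟩
  · refine Iff.trans ?_ (h.opFact.embedding_iff e.op)
    exact exists_congr fun R => (Fe.opForm_isEmbedding e R).symm
  · intro X Y Z pR pS R S hR hS
    exact (Fe.opForm_isEmbedding (pR ≫ pS) _).1
      (h.opFact.embedding_comp pS.op pR.op S R ((Fe.opForm_isEmbedding pS S).2 hS)
        ((Fe.opForm_isEmbedding pR R).2 hR))
  · intro X Y e R he
    obtain ⟨h1, h2, h3⟩ := h.opFact.embedding_N1 e.op R ((Fe.opForm_isEmbedding e R).2 he)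
    exact ⟨h1, h3, h2⟩
end

section
/- Let F be a form that is both strongly orean and noetherian, so that (F_c, F_n) is an orean factorization. For every conormal cluster A and every normal cluster R in the same object, the Wyler join A∗R (taken relative to the orean factorization (F_c, F_n)) equals the conormal interior of A ∨ R (the largest conormal cluster below A ∨ R, joins taken in F). Moreover, for any two conormal–normal pairs of F-clusters (A, R) and (B, S) in the same object satisfying A = A∗R, R ≥ α(A), B = B∗S and S ≥ α(B), where α denotes the conormal operator F_c → F_n, the inequality A ∨ R ≤ B ∨ S implies A ≤ B and R ≤ S. -/
open CategoryTheory

universe w v u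

/-- `W` is the Wyler join `A ∗ R` of an `F`-cluster `A` and a (normal) `F`-cluster `R`,
relative to the orean factorization `(F_c, F_n)`: for an `F_n`-quotient `p` of `R`
(equivalently, an `F`-quotient of `R`), `W` is the `F_c`-inverse image along `p` of the
`F_c`-direct image of `A` along `p` (direct and inverse images in the conormal hull,
characterized as least/greatest conormal clusters with the appropriate relation). -/
def WylerCN {C : Type u} [Category.{v} C] (F : OreanForm C) {X : C}
    (A R W : F.Cl X) : Prop :=
  ∃ (Q : C) (p : X ⟶ Q), F.IsQuotient p R ∧
    ∃ D : F.Cl Q,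
      (F.Conormal D ∧ F.Rel p A D ∧
        ∀ D' : F.Cl Q, F.Conormal D' → F.Rel p A D' → F.le D D') ∧
      (F.Conormal W ∧ F.Rel p W D ∧
        ∀ W' : F.Cl X, F.Conormal W' → F.Rel p W' D → F.le W' W)

section Helpers

variable {C : Type u} [Category.{v} C] (F : OreanForm C)

theorem OreanForm.rel_le {X Y : C} {f : X ⟶ Y} {A : F.Cl X} {B D : F.Cl Y}
    (h : F.Rel f A B) (h' : F.Rel (𝟙 Y) B D) : F.Rel f A D := by
  simpa using F.rel_comp h h'

theorem OreanForm.le_rel {X Y : C} {f : X ⟶ Y} {A B : F.Cl X} {D : F.Cl Y}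
    (h : F.Rel (𝟙 X) A B) (h' : F.Rel f B D) : F.Rel f A D := by
  simpa using F.rel_comp h h'

theorem OreanForm.le_trans'_s19 {X : C} {A B D : F.Cl X}
    (h : F.Rel (𝟙 X) A B) (h' : F.Rel (𝟙 X) B D) : F.Rel (𝟙 X) A D :=
  F.rel_le h h'

/-- The direct image of an image is the image of the composite. -/
theorem OreanForm.Im_comp_s19 {X Y Z : C} (f : X ⟶ Y) (g : Y ⟶ Z) :
    F.Im (f ≫ g) = F.dimg g (F.Im f) := by
  apply F.rel_antisymm
  · exact F.dimg_le (F.rel_comp (F.rel_dimg f _) (F.rel_dimg g _))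
  · obtain ⟨B, h1, h2⟩ := F.rel_decomp (F.rel_dimg (f ≫ g) (F.top X))
    exact F.dimg_le (F.le_rel (F.dimg_le h1) h2)

theorem OreanForm.wyler_interior (hN : F.IsNoetherian) {X : C} (A R W : F.Cl X)
    (hA : F.Conormal A) (h : WylerCN F A R W) : F.IsConormalInterior (F.join A R) W := by
  obtain ⟨Q, p, hp, D, ⟨_, hAD, hDmin⟩, hW, hWD, hWmax⟩ := h
  obtain ⟨V, f, rfl⟩ := hA
  have hD : F.Rel (𝟙 Q) D (F.dimg p (F.Im f)) :=
    hDmin _ ⟨V, f ≫ p, F.Im_comp_s19 f p⟩ (F.rel_dimg p _)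
  have key : F.iimg p (F.dimg p (F.Im f)) = F.join (F.Im f) R := by
    rw [(hN.1 p).1, hp.1]
  refine ⟨hW, ?_, ?_⟩
  · rw [← key]
    exact F.le_iimg (F.rel_le hWD hD)
  · intro T hT hTle
    rw [← key] at hTle
    exact hWmax T hT (F.rel_le (F.le_rel hTle (F.iimg_rel p _)) (F.dimg_le hAD))

theorem OreanForm.normal_le (hN : F.IsNoetherian)
    (α : Operator F.conormalHull F.normalHull) (hα : α.Conormal)
    {X Q : C} (R B S : F.Cl X) (hR : F.Normal R) (hB : F.Conormal B) (hS : F.Normal S)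
    (p : X ⟶ Q) (hp : F.IsQuotient p S)
    (hαB : F.le (α.app ⟨B, hB⟩).1 S) (hle : F.Rel (𝟙 X) R (F.join B S)) :
    F.Rel (𝟙 X) R S := by
  obtain ⟨Y, g, hg⟩ := hN.2.2.1 R S hR hS
  obtain ⟨k, hk, -⟩ := hp.2 g (by rw [hg]; exact F.le_join_right R S)
  obtain ⟨W, f, hf⟩ := id hB
  have htop : F.Conormal (F.top W) :=
    ⟨W, 𝟙 W, F.rel_antisymm (F.le_top _) (F.rel_dimg _ _)⟩
  have him : F.conormalHull.IsImageOf ⟨B, hB⟩ f := by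
    refine ⟨⟨F.top W, htop⟩, fun A => F.le_top A.1, ?_, ?_⟩
    · subst hf
      exact F.rel_dimg f _
    · intro T hT
      subst hf
      exact F.dimg_le hT
  obtain ⟨t, ht, hft, -⟩ := hα f _ him
  -- every normal cluster of `W` is sent to bottom by `f ≫ p`
  have hpS : F.Rel p S (F.bot Q) := by
    rw [← hp.1]
    exact F.iimg_rel p _
  have hbot : ∀ N : F.Cl W, F.Normal N → F.Rel (f ≫ p) N (F.bot Q) := fun N hNn =>
    F.le_rel (ht ⟨N, hNn⟩) (F.rel_comp (F.rel_le hft hαB) hpS)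
  -- `R` is related along `p` to the kernel of `k`
  have hRk : F.Rel p R (F.Ker k) := by
    have h1 : F.Rel (p ≫ k) R (F.bot Y) := by
      refine F.le_rel (F.le_join_left R S) ?_
      rw [← hg, ← hk]
      exact F.iimg_rel _ _
    obtain ⟨E, h2, h3⟩ := F.rel_decomp h1
    exact F.rel_le h2 (F.le_iimg h3)
  have hRim : F.Rel p R (F.Im (f ≫ p)) := by
    rw [F.Im_comp_s19, hf]
    refine F.le_rel (F.le_trans'_s19 hle ?_) (F.iimg_rel p _)
    rw [(hN.1 p).1, hp.1]
    exact F.rel_id _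
  have hRm : F.Rel p R (F.meet (F.Ker k) (F.Im (f ≫ p))) :=
    F.rel_le (F.rel_dimg p R) (F.le_meet (F.dimg_le hRk) (F.dimg_le hRim))
  have hnorm : F.Normal (F.iimg (f ≫ p) (F.Ker k)) := by
    refine ⟨Y, (f ≫ p) ≫ k, F.rel_antisymm ?_ ?_⟩
    · obtain ⟨E, h2, h3⟩ := F.rel_decomp (F.iimg_rel ((f ≫ p) ≫ k) (F.bot Y))
      exact F.le_iimg (F.rel_le h2 (F.le_iimg h3))
    · exact F.le_iimg (F.rel_comp (F.iimg_rel _ _) (F.iimg_rel _ _))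
  rw [← (hN.1 (f ≫ p)).2] at hRm
  have := F.le_iimg (F.rel_le hRm (F.dimg_le (hbot _ hnorm)))
  rw [← hp.1]
  exact this

end Helpers

/-- Lemma: for a strongly orean noetherian form `F`, the Wyler join `A ∗ R` (relative
to the orean factorization `(F_c, F_n)`) of a conormal cluster `A` and a normal cluster
`R` is the conormal interior of `A ∨ R`; moreover for conormal–normal pairs `(A, R)`,
`(B, S)` with `A = A ∗ R`, `R ≥ α A`, `B = B ∗ S`, `S ≥ α B` (where `α` is the conormal
operator `F_c → F_n`), `A ∨ R ≤ B ∨ S` implies `A ≤ B` and `R ≤ S`. -/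
theorem wyler_join_eq_conormal_interior {C : Type u} [Category.{v} C]
    (F : OreanForm C) (hN : F.IsNoetherian) (hSO : F.StronglyOrean)
    (α : Operator F.conormalHull F.normalHull) (hα : α.Conormal) :
    (∀ {X : C} (A R W : F.Cl X), F.Conormal A → F.Normal R →
      WylerCN F A R W → F.IsConormalInterior (F.join A R) W) ∧
    (∀ {X : C} (A R B S : F.Cl X) (hA : F.Conormal A) (_hR : F.Normal R)
        (hB : F.Conormal B) (_hS : F.Normal S),
      WylerCN F A R A → F.le (α.app ⟨A, hA⟩).1 R →
      WylerCN F B S B → F.le (α.app ⟨B, hB⟩).1 S →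
      F.le (F.join A R) (F.join B S) → F.le A B ∧ F.le R S) := by
  refine ⟨fun A R W hA _ h => F.wyler_interior hN A R W hA h, ?_⟩
  intro X A R B S hA hR hB hS _ _ hWB hαB hle
  have hint := F.wyler_interior hN B S B hB hWB
  refine ⟨hint.2.2 A hA (F.le_trans'_s19 (F.le_join_left A R) hle), ?_⟩
  obtain ⟨Q, p, hp, -⟩ := hWB
  exact F.normal_le hN α hα R B S hR hB hS p hp hαB
    (F.le_trans'_s19 (F.le_join_right A R) hle)
end
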